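/- arXiv:2211.10523 — 4 statements merged into one kernel-verified Lean document; each statement's English description precedes it below -/
import Mathlib

section
/- For every real number $s$ with $0 < s < 1$, one has the identity $K(1-1/s^2) - s^2 E(1-1/s^2) = s(1-s^2)\int_0^1 \frac{\sqrt{1-t^2}}{\sqrt{(1-t^2)s^2+t^2}}\,dt$. -/
open MeasureTheory

/-- Complete elliptic integral of the second kind, `E(k) = ∫₀¹ √(1-kt²)/√(1-t²) dt`. -/
noncomputable def ellipticE (k : ℝ) : ℝ :=
  ∫ t in (0:ℝ)..1, Real.sqrt (1 - k * t ^ 2) / Real.sqrt (1 - t ^ 2)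

/-- Complete elliptic integral of the first kind, `K(k) = ∫₀¹ dt/√((1-t²)(1-kt²))`. -/
noncomputable def ellipticK (k : ℝ) : ℝ :=
  ∫ t in (0:ℝ)..1, 1 / Real.sqrt ((1 - t ^ 2) * (1 - k * t ^ 2))

/-- The derivative `1 / √(1 - t²)` of `arcsin` is integrable on `[0, 1]`. -/
theorem intervalIntegrable_one_div_sqrt_one_sub_sq :
    IntervalIntegrable (fun t : ℝ => 1 / Real.sqrt (1 - t ^ 2)) volume 0 1 := by
  refine intervalIntegral.intervalIntegrable_deriv_of_nonneg
    (g := Real.arcsin) Real.continuous_arcsin.continuousOn ?_ ?_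
  · intro t ht
    simp only [zero_le_one, min_eq_left, max_eq_right, Set.mem_Ioo] at ht
    exact Real.hasDerivAt_arcsin (by linarith) (by linarith)
  · intro t _
    positivity

theorem one_sub_mul_sq_pos {k : ℝ} (hk : k ≤ 0) (t : ℝ) : 0 < 1 - k * t ^ 2 := by
  nlinarith [mul_nonneg (neg_nonneg.2 hk) (sq_nonneg t)]

theorem intervalIntegrable_ellipticE {k : ℝ} :
    IntervalIntegrable (fun t : ℝ => Real.sqrt (1 - k * t ^ 2) / Real.sqrt (1 - t ^ 2))
      volume 0 1 := by
  have h := intervalIntegrable_one_div_sqrt_one_sub_sq.continuousOn_mul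
    (g := fun t : ℝ => Real.sqrt (1 - k * t ^ 2)) (by fun_prop)
  simpa only [mul_one_div] using h

theorem intervalIntegrable_ellipticK {k : ℝ} (hk : k ≤ 0) :
    IntervalIntegrable (fun t : ℝ => 1 / Real.sqrt ((1 - t ^ 2) * (1 - k * t ^ 2)))
      volume 0 1 := by
  have h := intervalIntegrable_one_div_sqrt_one_sub_sq.mul_continuousOn
    (g := fun t : ℝ => 1 / Real.sqrt (1 - k * t ^ 2))
    (ContinuousOn.div (by fun_prop) (by fun_prop)
      fun t _ => (Real.sqrt_pos.2 (one_sub_mul_sq_pos hk t)).ne')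
  convert h using 2 with t
  rw [Real.sqrt_mul' _ (one_sub_mul_sq_pos hk t).le, one_div_mul_one_div]

/-- For `0 < s < 1`,
`K(1-1/s²) - s²E(1-1/s²) = s(1-s²) ∫₀¹ √(1-t²)/√((1-t²)s²+t²) dt`. -/
theorem ellipticK_sub_sq_mul_ellipticE_eq (s : ℝ) (hs0 : 0 < s) (hs1 : s < 1) :
    ellipticK (1 - 1 / s ^ 2) - s ^ 2 * ellipticE (1 - 1 / s ^ 2) =
      s * (1 - s ^ 2) *
        ∫ t in (0:ℝ)..1, Real.sqrt (1 - t ^ 2) / Real.sqrt ((1 - t ^ 2) * s ^ 2 + t ^ 2) := by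
  have hk : 1 - 1 / s ^ 2 ≤ 0 :=
    sub_nonpos.2 <| (one_le_div (by positivity)).2 (pow_le_one₀ hs0.le hs1.le)
  rw [ellipticK, ellipticE, ← intervalIntegral.integral_const_mul,
    ← intervalIntegral.integral_const_mul, ← intervalIntegral.integral_sub
      (intervalIntegrable_ellipticK hk) (intervalIntegrable_ellipticE.const_mul _)]
  refine intervalIntegral.integral_congr fun t ht => ?_
  have hpos := one_sub_mul_sq_pos hk t
  have hD : (1 - t ^ 2) * s ^ 2 + t ^ 2 = s ^ 2 * (1 - (1 - 1 / s ^ 2) * t ^ 2) := by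
    field_simp
    ring
  simp only [hD]
  rw [Real.sqrt_mul' _ hpos.le, Real.sqrt_mul (sq_nonneg s), Real.sqrt_sq hs0.le]
  rw [Set.uIcc_of_le zero_le_one] at ht
  obtain rfl | ht1 := ht.2.eq_or_lt
  · simp
  have ha : 0 < 1 - t ^ 2 := by nlinarith [ht.1]
  have hA := Real.sq_sqrt ha.le
  have hB := Real.sq_sqrt hpos.le
  have hA0 := Real.sqrt_pos.2 ha
  have hB0 := Real.sqrt_pos.2 hpos
  have key : 1 - s ^ 2 * (1 - (1 - 1 / s ^ 2) * t ^ 2) = (1 - s ^ 2) * (1 - t ^ 2) := by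
    rw [← hD]
    ring
  rw [← hA, ← hB] at key
  generalize Real.sqrt (1 - t ^ 2) = a at *
  generalize Real.sqrt (1 - (1 - 1 / s ^ 2) * t ^ 2) = b at *
  calc 1 / (a * b) - s ^ 2 * (b / a) = (1 - s ^ 2 * b ^ 2) / (a * b) := by field_simp
    _ = s * (1 - s ^ 2) * (a / (s * b)) := by
      rw [key]
      field_simp
end

section
/- As $s \to 0^+$, one has $s \cdot E(1-1/s^2) \to 1$, i.e. the limit of $s\,E(1-1/s^2)$ as $s$ tends to $0$ from the right equals $1$. -/
open MeasureTheory Filter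

lemma hasDerivAt_neg_sqrt_one_sub_sq {t : ℝ} (ht : t ∈ Set.Ioo (0 : ℝ) 1) :
    HasDerivAt (fun t : ℝ => -Real.sqrt (1 - t ^ 2)) (t / Real.sqrt (1 - t ^ 2)) t := by
  have h : 0 < 1 - t ^ 2 := by nlinarith [ht.1, ht.2]
  have hd := ((((hasDerivAt_id t).pow 2).const_sub 1).sqrt h.ne').neg
  refine hd.congr_deriv ?_
  have := (Real.sqrt_pos.mpr h).ne'
  simp
  field_simp

lemma continuousOn_neg_sqrt_one_sub_sq :
    ContinuousOn (fun t : ℝ => -Real.sqrt (1 - t ^ 2)) (Set.Icc 0 1) := by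
  fun_prop

lemma intervalIntegrable_div_sqrt_one_sub_sq :
    IntervalIntegrable (fun t : ℝ => t / Real.sqrt (1 - t ^ 2)) volume 0 1 := by
  rw [intervalIntegrable_iff_integrableOn_Ioc_of_le zero_le_one]
  exact intervalIntegral.integrableOn_deriv_of_nonneg continuousOn_neg_sqrt_one_sub_sq
    (fun t ht => hasDerivAt_neg_sqrt_one_sub_sq ht)
    fun t ht => div_nonneg ht.1.le (Real.sqrt_nonneg _)

lemma integral_div_sqrt_one_sub_sq :
    ∫ t in (0 : ℝ)..1, t / Real.sqrt (1 - t ^ 2) = 1 := by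
  rw [intervalIntegral.integral_eq_sub_of_hasDerivAt_of_le zero_le_one
    continuousOn_neg_sqrt_one_sub_sq (fun t ht => hasDerivAt_neg_sqrt_one_sub_sq ht)
    intervalIntegrable_div_sqrt_one_sub_sq]
  simp

lemma mul_ellipticE_eq {s : ℝ} (hs : 0 < s) :
    s * ellipticE (1 - 1 / s ^ 2) =
      ∫ t in (0 : ℝ)..1, Real.sqrt (s ^ 2 * (1 - t ^ 2) + t ^ 2) / Real.sqrt (1 - t ^ 2) := by
  rw [ellipticE, ← intervalIntegral.integral_const_mul]
  congr 1 with t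
  rw [← mul_div_assoc]
  congr 1
  have h : s ^ 2 * (1 - t ^ 2) + t ^ 2 = s ^ 2 * (1 - (1 - 1 / s ^ 2) * t ^ 2) := by
    field_simp
    ring
  rw [h, Real.sqrt_mul (sq_nonneg s), Real.sqrt_sq hs.le]

lemma sqrt_div_sqrt_one_sub_sq_le {s t : ℝ} (hs : s ∈ Set.Ioo (0 : ℝ) 1)
    (ht : t ∈ Set.Ioc (0 : ℝ) 1) :
    Real.sqrt (s ^ 2 * (1 - t ^ 2) + t ^ 2) / Real.sqrt (1 - t ^ 2) ≤
      t / Real.sqrt (1 - t ^ 2) + 1 := by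
  have h : 0 ≤ 1 - t ^ 2 := by nlinarith [ht.1, ht.2]
  have hsq := Real.sq_sqrt h
  have hn := Real.sqrt_nonneg (1 - t ^ 2)
  have hle : Real.sqrt (s ^ 2 * (1 - t ^ 2) + t ^ 2) ≤ t + Real.sqrt (1 - t ^ 2) := by
    rw [Real.sqrt_le_left (add_nonneg ht.1.le hn)]
    have hs1 : s ^ 2 ≤ 1 := by nlinarith [hs.1, hs.2]
    nlinarith [mul_nonneg ht.1.le hn, mul_nonneg (sub_nonneg.2 hs1) h]
  calc _ ≤ (t + Real.sqrt (1 - t ^ 2)) / Real.sqrt (1 - t ^ 2) := by gcongr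
    _ = t / Real.sqrt (1 - t ^ 2) + Real.sqrt (1 - t ^ 2) / Real.sqrt (1 - t ^ 2) := add_div ..
    _ ≤ _ := by gcongr; exact div_self_le_one _

/-- As `s → 0⁺`, `s · E(1-1/s²) → 1`. -/
theorem tendsto_mul_ellipticE :
    Tendsto (fun s : ℝ => s * ellipticE (1 - 1 / s ^ 2))
      (nhdsWithin 0 (Set.Ioi 0)) (nhds 1) := by
  suffices h : Tendsto (fun s : ℝ => s * ellipticE (1 - 1 / s ^ 2)) (nhdsWithin 0 (Set.Ioi 0))
      (nhds (∫ t in (0 : ℝ)..1, t / Real.sqrt (1 - t ^ 2))) by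
    rwa [integral_div_sqrt_one_sub_sq] at h
  refine Tendsto.congr' (f₁ := fun s : ℝ => ∫ t in (0 : ℝ)..1,
    Real.sqrt (s ^ 2 * (1 - t ^ 2) + t ^ 2) / Real.sqrt (1 - t ^ 2)) ?_ ?_
  · filter_upwards [self_mem_nhdsWithin] with s hs using (mul_ellipticE_eq hs).symm
  refine intervalIntegral.tendsto_integral_filter_of_dominated_convergence
    (fun t => t / Real.sqrt (1 - t ^ 2) + 1) ?_ ?_
    (intervalIntegrable_div_sqrt_one_sub_sq.add intervalIntegrable_const) ?_
  · refine Eventually.of_forall fun s => Measurable.aestronglyMeasurable ?_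
    fun_prop
  · filter_upwards [Ioo_mem_nhdsGT zero_lt_one] with s hs
    refine Eventually.of_forall fun t ht => ?_
    rw [Set.uIoc_of_le zero_le_one] at ht
    rw [Real.norm_of_nonneg (by positivity)]
    exact sqrt_div_sqrt_one_sub_sq_le hs ht
  · refine Eventually.of_forall fun t ht => tendsto_nhdsWithin_of_tendsto_nhds ?_
    rw [Set.uIoc_of_le zero_le_one] at ht
    have hc : Continuous fun s : ℝ =>
        Real.sqrt (s ^ 2 * (1 - t ^ 2) + t ^ 2) / Real.sqrt (1 - t ^ 2) := by
      fun_prop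
    simpa [Real.sqrt_sq ht.1.le] using hc.tendsto 0
end

section
/- For every real number $s$ with $0 < s < 1$, the function $\Phi$ is differentiable at $s$ with derivative $\Phi'(s) = -\frac{32}{\pi^2}\big(K(1-1/s^2) - s^2E(1-1/s^2)\big)$; in particular $|\Phi'(s)| = \frac{32}{\pi^2}\big(K(1-1/s^2) - s^2E(1-1/s^2)\big)$. -/
open MeasureTheory

/-- The Sato–Tate trace density `Φ`. -/
noncomputable def Phi (s : ℝ) : ℝ :=
  if s = 0 then 32 / (3 * Real.pi ^ 2)
  else 32 * |s| / (3 * Real.pi ^ 2) *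
    ((s ^ 2 + 1) * ellipticE (1 - 1 / s ^ 2) - 2 * ellipticK (1 - 1 / s ^ 2))

/-- `√(s² cos² θ + sin² θ)`, the integrand of `s E(1 - 1/s²)` after the substitution `t = sin θ`. -/
noncomputable def ellipticDelta (s θ : ℝ) : ℝ :=
  Real.sqrt (s ^ 2 * Real.cos θ ^ 2 + Real.sin θ ^ 2)

lemma ellipticDelta_radicand_pos {s : ℝ} (hs : 0 < s) (θ : ℝ) :
    0 < s ^ 2 * Real.cos θ ^ 2 + Real.sin θ ^ 2 := by
  rcases eq_or_ne (Real.sin θ) 0 with h | h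
  · have := Real.sin_sq_add_cos_sq θ
    have hc : Real.cos θ ^ 2 = 1 := by rw [h] at this; linarith
    rw [hc, h]; positivity
  · positivity

lemma ellipticDelta_pos {s : ℝ} (hs : 0 < s) (θ : ℝ) : 0 < ellipticDelta s θ :=
  Real.sqrt_pos.2 (ellipticDelta_radicand_pos hs θ)

lemma ellipticDelta_sq (s θ : ℝ) :
    ellipticDelta s θ ^ 2 = s ^ 2 * Real.cos θ ^ 2 + Real.sin θ ^ 2 :=
  Real.sq_sqrt (by positivity)

lemma continuous_ellipticDelta (s : ℝ) : Continuous (ellipticDelta s) := by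
  unfold ellipticDelta; fun_prop

lemma continuous_ellipticDelta_inv {s : ℝ} (hs : 0 < s) :
    Continuous fun θ => (ellipticDelta s θ)⁻¹ :=
  (continuous_ellipticDelta s).inv₀ fun θ => (ellipticDelta_pos hs θ).ne'

lemma intervalIntegral_comp_sin (g : ℝ → ℝ) :
    ∫ t in (0:ℝ)..1, g t = ∫ θ in (0:ℝ)..(Real.pi / 2), Real.cos θ * g (Real.sin θ) := by
  have hpi := Real.pi_pos
  have himg : Real.sin '' Set.Ioo 0 (Real.pi / 2) = Set.Ioo 0 1 := by
    ext t
    constructor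
    · rintro ⟨θ, ⟨h0, h1⟩, rfl⟩
      refine ⟨Real.sin_pos_of_pos_of_lt_pi h0 (by linarith), ?_⟩
      rw [← Real.sin_pi_div_two]
      exact Real.sin_lt_sin_of_lt_of_le_pi_div_two (by linarith) le_rfl h1
    · rintro ⟨h0, h1⟩
      exact ⟨Real.arcsin t, ⟨Real.arcsin_pos.2 h0, Real.arcsin_lt_pi_div_two.2 h1⟩,
        Real.sin_arcsin (by linarith) h1.le⟩
  have hinj : Set.InjOn Real.sin (Set.Ioo 0 (Real.pi / 2)) :=
    Real.injOn_sin.mono (Set.Ioo_subset_Icc_self.trans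
      (Set.Icc_subset_Icc (by linarith) le_rfl))
  rw [intervalIntegral.integral_of_le zero_le_one,
    intervalIntegral.integral_of_le (by positivity),
    integral_Ioc_eq_integral_Ioo, integral_Ioc_eq_integral_Ioo, ← himg,
    integral_image_eq_integral_abs_deriv_smul measurableSet_Ioo
      (fun θ _ => (Real.hasDerivAt_sin θ).hasDerivWithinAt) hinj]
  refine setIntegral_congr_fun measurableSet_Ioo fun θ hθ => ?_
  have hc : 0 < Real.cos θ := Real.cos_pos_of_mem_Ioo ⟨by linarith [hθ.1], hθ.2⟩
  simp only [abs_of_pos hc, smul_eq_mul]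

lemma intervalIntegral_congr_cos_pos {f g : ℝ → ℝ}
    (h : ∀ θ, 0 < Real.cos θ → f θ = g θ) :
    ∫ θ in (0:ℝ)..(Real.pi / 2), f θ = ∫ θ in (0:ℝ)..(Real.pi / 2), g θ := by
  have hpi := Real.pi_pos
  rw [intervalIntegral.integral_of_le (by positivity),
    intervalIntegral.integral_of_le (by positivity),
    integral_Ioc_eq_integral_Ioo, integral_Ioc_eq_integral_Ioo]
  exact setIntegral_congr_fun measurableSet_Ioo fun θ hθ =>
    h θ (Real.cos_pos_of_mem_Ioo ⟨by linarith [hθ.1], hθ.2⟩)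

lemma sqrt_one_sub_mul_sin_sq {s : ℝ} (hs : 0 < s) (θ : ℝ) :
    Real.sqrt (1 - (1 - 1 / s ^ 2) * Real.sin θ ^ 2) = ellipticDelta s θ / s := by
  have hc := Real.cos_sq' θ
  rw [show 1 - (1 - 1 / s ^ 2) * Real.sin θ ^ 2
      = (s ^ 2 * Real.cos θ ^ 2 + Real.sin θ ^ 2) / s ^ 2 by rw [hc]; field_simp; ring,
    Real.sqrt_div (by positivity), Real.sqrt_sq hs.le, ellipticDelta]

lemma mul_ellipticE_eq_integral {s : ℝ} (hs : 0 < s) :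
    s * ellipticE (1 - 1 / s ^ 2) = ∫ θ in (0:ℝ)..(Real.pi / 2), ellipticDelta s θ := by
  rw [ellipticE, intervalIntegral_comp_sin, ← intervalIntegral.integral_const_mul]
  refine intervalIntegral_congr_cos_pos fun θ hc => ?_
  rw [sqrt_one_sub_mul_sin_sq hs, ← Real.cos_sq', Real.sqrt_sq hc.le]
  field_simp

lemma ellipticK_eq_integral {s : ℝ} (hs : 0 < s) :
    ellipticK (1 - 1 / s ^ 2) = s * ∫ θ in (0:ℝ)..(Real.pi / 2), (ellipticDelta s θ)⁻¹ := by
  rw [ellipticK, intervalIntegral_comp_sin, ← intervalIntegral.integral_const_mul]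
  refine intervalIntegral_congr_cos_pos fun θ hc => ?_
  have hd := ellipticDelta_pos hs θ
  rw [← Real.cos_sq', Real.sqrt_mul (by positivity), sqrt_one_sub_mul_sin_sq hs,
    Real.sqrt_sq hc.le]
  field_simp

lemma hasDerivAt_ellipticDelta {s : ℝ} (hs : 0 < s) (θ : ℝ) :
    HasDerivAt (fun x => ellipticDelta x θ) (s * Real.cos θ ^ 2 * (ellipticDelta s θ)⁻¹) s := by
  have h := (((hasDerivAt_pow 2 s).mul_const (Real.cos θ ^ 2)).add_const
    (Real.sin θ ^ 2)).sqrt (ellipticDelta_radicand_pos hs θ).ne'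
  refine h.congr_deriv ?_
  have hd := ellipticDelta_pos hs θ
  change _ / (2 * ellipticDelta s θ) = _
  field_simp
  norm_num
  ring

lemma hasDerivAt_ellipticDelta_inv {s : ℝ} (hs : 0 < s) (θ : ℝ) :
    HasDerivAt (fun x => (ellipticDelta x θ)⁻¹)
      (-(s * Real.cos θ ^ 2 * (ellipticDelta s θ)⁻¹ ^ 3)) s := by
  have hd := ellipticDelta_pos hs θ
  refine ((hasDerivAt_ellipticDelta hs θ).fun_inv hd.ne').congr_deriv ?_
  field_simp

lemma mul_abs_cos_le_ellipticDelta {s : ℝ} (hs : 0 < s) (θ : ℝ) :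
    s * |Real.cos θ| ≤ ellipticDelta s θ := by
  refine abs_le_of_sq_le_sq' ?_ (ellipticDelta_pos hs θ).le |>.2
  rw [ellipticDelta_sq, mul_pow, sq_abs]
  linarith [sq_nonneg (Real.sin θ)]

lemma mul_cos_sq_mul_ellipticDelta_inv_le {s : ℝ} (hs : 0 < s) (θ : ℝ) :
    s * Real.cos θ ^ 2 * (ellipticDelta s θ)⁻¹ ≤ 1 := by
  have hd := ellipticDelta_pos hs θ
  rw [← div_eq_mul_inv, div_le_one hd]
  refine le_trans ?_ (mul_abs_cos_le_ellipticDelta hs θ)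
  rw [← sq_abs]
  gcongr
  nlinarith [abs_nonneg (Real.cos θ), Real.abs_cos_le_one θ]

lemma le_ellipticDelta {c s : ℝ} (hc : 0 < c) (hc1 : c ≤ 1) (hcs : c ≤ s) (θ : ℝ) :
    c ≤ ellipticDelta s θ := by
  refine Real.le_sqrt_of_sq_le ?_
  have h1 : c ^ 2 ≤ s ^ 2 := by gcongr
  have h2 : c ^ 2 ≤ 1 := pow_le_one₀ hc.le hc1
  nlinarith [Real.sin_sq_add_cos_sq θ, sq_nonneg (Real.sin θ), sq_nonneg (Real.cos θ)]

lemma hasDerivAt_integral_ellipticDelta {s : ℝ} (hs : 0 < s) :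
    HasDerivAt (fun x => ∫ θ in (0:ℝ)..(Real.pi / 2), ellipticDelta x θ)
      (∫ θ in (0:ℝ)..(Real.pi / 2), s * Real.cos θ ^ 2 * (ellipticDelta s θ)⁻¹) s := by
  refine (intervalIntegral.hasDerivAt_integral_of_dominated_loc_of_deriv_le
    (F' := fun x θ => x * Real.cos θ ^ 2 * (ellipticDelta x θ)⁻¹) (bound := fun _ => 1)
    (Ioi_mem_nhds hs) (.of_forall fun x => (continuous_ellipticDelta x).aestronglyMeasurable)
    ((continuous_ellipticDelta s).intervalIntegrable _ _) ?_ ?_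
    intervalIntegrable_const ?_).2
  · have := continuous_ellipticDelta_inv hs
    exact Continuous.aestronglyMeasurable (by fun_prop)
  · refine .of_forall fun θ _ x hx => ?_
    have hd := ellipticDelta_pos hx θ
    have hx' : 0 < x := hx
    rw [Real.norm_of_nonneg (by positivity)]
    exact mul_cos_sq_mul_ellipticDelta_inv_le hx θ
  · exact .of_forall fun θ _ x hx => hasDerivAt_ellipticDelta hx θ

lemma hasDerivAt_integral_ellipticDelta_inv {s : ℝ} (hs : 0 < s) :
    HasDerivAt (fun x => ∫ θ in (0:ℝ)..(Real.pi / 2), (ellipticDelta x θ)⁻¹)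
      (∫ θ in (0:ℝ)..(Real.pi / 2), -(s * Real.cos θ ^ 2 * (ellipticDelta s θ)⁻¹ ^ 3)) s := by
  obtain ⟨c, hc, hc1⟩ : ∃ c, 0 < c ∧ c < min 1 s := exists_between (by positivity)
  have hcs : c < s := hc1.trans_le (min_le_right _ _)
  have hc1 : c ≤ 1 := hc1.le.trans (min_le_left _ _)
  refine (intervalIntegral.hasDerivAt_integral_of_dominated_loc_of_deriv_le
    (F' := fun x θ => -(x * Real.cos θ ^ 2 * (ellipticDelta x θ)⁻¹ ^ 3))
    (bound := fun _ => c⁻¹ ^ 2) (Ioi_mem_nhds hcs) ?_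
    ((continuous_ellipticDelta_inv hs).intervalIntegrable _ _) ?_ ?_
    intervalIntegrable_const ?_).2
  · filter_upwards [Ioi_mem_nhds hs] with x hx
    exact (continuous_ellipticDelta_inv hx).aestronglyMeasurable
  · have := continuous_ellipticDelta_inv hs
    exact Continuous.aestronglyMeasurable (by fun_prop)
  · refine .of_forall fun θ _ x hx => ?_
    have hx0 : 0 < x := hc.trans hx
    have hd := ellipticDelta_pos hx0 θ
    rw [norm_neg, Real.norm_of_nonneg (by positivity), pow_succ' _ 2, ← mul_assoc]
    have hle := le_ellipticDelta hc hc1 (le_of_lt hx) θ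
    calc _ ≤ 1 * (ellipticDelta x θ)⁻¹ ^ 2 := by
          gcongr; exact mul_cos_sq_mul_ellipticDelta_inv_le hx0 θ
      _ ≤ c⁻¹ ^ 2 := by rw [one_mul]; gcongr
  · exact .of_forall fun θ _ x hx => hasDerivAt_ellipticDelta_inv (hc.trans hx) θ

lemma hasDerivAt_sin_mul_cos_mul_ellipticDelta_inv {s : ℝ} (hs : 0 < s) (θ : ℝ) :
    HasDerivAt (fun x => (1 - s ^ 2) * (Real.sin x * Real.cos x * (ellipticDelta s x)⁻¹))
      (s ^ 2 * (ellipticDelta s θ)⁻¹ ^ 3 - ellipticDelta s θ) θ := by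
  have hd := ellipticDelta_pos hs θ
  have hD : HasDerivAt (ellipticDelta s)
      ((1 - s ^ 2) * Real.sin θ * Real.cos θ * (ellipticDelta s θ)⁻¹) θ := by
    have h := ((((Real.hasDerivAt_cos θ).fun_pow 2).const_mul (s ^ 2)).fun_add
      ((Real.hasDerivAt_sin θ).fun_pow 2)).sqrt (ellipticDelta_radicand_pos hs θ).ne'
    refine h.congr_deriv ?_
    change _ / (2 * ellipticDelta s θ) = _
    field_simp
    norm_num
    ring
  refine ((((Real.hasDerivAt_sin θ).fun_mul (Real.hasDerivAt_cos θ)).fun_mul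
    (hD.fun_inv hd.ne')).const_mul (1 - s ^ 2)).congr_deriv ?_
  have hsq := ellipticDelta_sq s θ
  have h4 : ellipticDelta s θ ^ 4 = (s ^ 2 * Real.cos θ ^ 2 + Real.sin θ ^ 2) ^ 2 := by
    rw [← hsq]; ring
  have hc := Real.cos_sq' θ
  field_simp
  simp only [h4, hsq, hc]
  grind

lemma sq_mul_integral_ellipticDelta_inv_cube {s : ℝ} (hs : 0 < s) :
    s ^ 2 * ∫ θ in (0:ℝ)..(Real.pi / 2), (ellipticDelta s θ)⁻¹ ^ 3 =
      ∫ θ in (0:ℝ)..(Real.pi / 2), ellipticDelta s θ := by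
  have h1 := continuous_ellipticDelta s
  have h2 := continuous_ellipticDelta_inv hs
  have h3 : Continuous fun θ => s ^ 2 * (ellipticDelta s θ)⁻¹ ^ 3 := by fun_prop
  have h := intervalIntegral.integral_eq_sub_of_hasDerivAt (a := 0) (b := Real.pi / 2)
    (fun θ _ => hasDerivAt_sin_mul_cos_mul_ellipticDelta_inv hs θ)
    ((h3.sub h1).intervalIntegrable _ _)
  rw [intervalIntegral.integral_sub (h3.intervalIntegrable _ _) (h1.intervalIntegrable _ _),
    intervalIntegral.integral_const_mul] at h
  simp only [Real.cos_pi_div_two, Real.sin_zero, mul_zero, zero_mul, sub_zero] at h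
  linarith

lemma integral_deriv_ellipticDelta {s : ℝ} (hs : 0 < s) :
    (1 - s ^ 2) * ∫ θ in (0:ℝ)..(Real.pi / 2), s * Real.cos θ ^ 2 * (ellipticDelta s θ)⁻¹ =
      s * ((∫ θ in (0:ℝ)..(Real.pi / 2), (ellipticDelta s θ)⁻¹) -
        ∫ θ in (0:ℝ)..(Real.pi / 2), ellipticDelta s θ) := by
  rw [← intervalIntegral.integral_sub
    ((continuous_ellipticDelta_inv hs).intervalIntegrable _ _)
    ((continuous_ellipticDelta s).intervalIntegrable _ _),
    ← intervalIntegral.integral_const_mul, ← intervalIntegral.integral_const_mul]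
  refine intervalIntegral.integral_congr fun θ _ => ?_
  have hd := ellipticDelta_pos hs θ
  have hsq := ellipticDelta_sq s θ
  have hc := Real.sin_sq θ
  field_simp
  rw [hsq, hc]
  ring

lemma integral_deriv_ellipticDelta_inv {s : ℝ} (hs : 0 < s) :
    (1 - s ^ 2) *
        ∫ θ in (0:ℝ)..(Real.pi / 2), -(s * Real.cos θ ^ 2 * (ellipticDelta s θ)⁻¹ ^ 3) =
      s * ((∫ θ in (0:ℝ)..(Real.pi / 2), (ellipticDelta s θ)⁻¹) -
        ∫ θ in (0:ℝ)..(Real.pi / 2), (ellipticDelta s θ)⁻¹ ^ 3) := by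
  have hi := continuous_ellipticDelta_inv hs
  rw [← intervalIntegral.integral_sub (hi.intervalIntegrable _ _)
    ((by fun_prop : Continuous fun θ => (ellipticDelta s θ)⁻¹ ^ 3).intervalIntegrable _ _),
    ← intervalIntegral.integral_const_mul, ← intervalIntegral.integral_const_mul]
  refine intervalIntegral.integral_congr fun θ _ => ?_
  have hd := ellipticDelta_pos hs θ
  have hsq := ellipticDelta_sq s θ
  have hc := Real.sin_sq θ
  field_simp
  rw [hsq, hc]
  ring

lemma integral_ellipticDelta_le_integral_inv {s : ℝ} (hs0 : 0 < s) (hs1 : s ≤ 1) :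
    ∫ θ in (0:ℝ)..(Real.pi / 2), ellipticDelta s θ ≤
      ∫ θ in (0:ℝ)..(Real.pi / 2), (ellipticDelta s θ)⁻¹ := by
  refine intervalIntegral.integral_mono_on (by positivity)
    ((continuous_ellipticDelta s).intervalIntegrable _ _)
    ((continuous_ellipticDelta_inv hs0).intervalIntegrable _ _) fun θ _ => ?_
  have hd := ellipticDelta_pos hs0 θ
  have hle : ellipticDelta s θ ≤ 1 := by
    refine Real.sqrt_le_one.2 ?_
    have : s ^ 2 ≤ 1 := pow_le_one₀ hs0.le hs1
    nlinarith [Real.sin_sq_add_cos_sq θ, sq_nonneg (Real.cos θ)]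
  exact hle.trans ((one_le_inv₀ hd).2 hle)

lemma Phi_eq_integral {s : ℝ} (hs : 0 < s) :
    Phi s = 32 / (3 * Real.pi ^ 2) *
      ((s ^ 2 + 1) * (∫ θ in (0:ℝ)..(Real.pi / 2), ellipticDelta s θ) -
        2 * (s ^ 2 * ∫ θ in (0:ℝ)..(Real.pi / 2), (ellipticDelta s θ)⁻¹)) := by
  rw [Phi, if_neg hs.ne', abs_of_pos hs, ← mul_ellipticE_eq_integral hs,
    ellipticK_eq_integral hs]
  ring

/-- For `0 < s < 1`, `Φ` is differentiable at `s` with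
`Φ'(s) = -(32/π²)(K(1-1/s²) - s²E(1-1/s²))`; in particular
`|Φ'(s)| = (32/π²)(K(1-1/s²) - s²E(1-1/s²))`. -/
theorem phi_hasDerivAt (s : ℝ) (hs0 : 0 < s) (hs1 : s < 1) :
    HasDerivAt Phi
      (-(32 / Real.pi ^ 2) *
        (ellipticK (1 - 1 / s ^ 2) - s ^ 2 * ellipticE (1 - 1 / s ^ 2))) s ∧
    |(-(32 / Real.pi ^ 2) *
        (ellipticK (1 - 1 / s ^ 2) - s ^ 2 * ellipticE (1 - 1 / s ^ 2)))| =
      32 / Real.pi ^ 2 *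
        (ellipticK (1 - 1 / s ^ 2) - s ^ 2 * ellipticE (1 - 1 / s ^ 2)) := by
  have hK := ellipticK_eq_integral hs0
  have hE := mul_ellipticE_eq_integral hs0
  have hdA := hasDerivAt_integral_ellipticDelta hs0
  have hdB := hasDerivAt_integral_ellipticDelta_inv hs0
  have hA := integral_deriv_ellipticDelta hs0
  have hB := integral_deriv_ellipticDelta_inv hs0
  have hC := sq_mul_integral_ellipticDelta_inv_cube hs0
  have hle := integral_ellipticDelta_le_integral_inv hs0 hs1.le
  have hKE : ellipticK (1 - 1 / s ^ 2) - s ^ 2 * ellipticE (1 - 1 / s ^ 2) =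
      s * ((∫ θ in (0:ℝ)..(Real.pi / 2), (ellipticDelta s θ)⁻¹) -
        ∫ θ in (0:ℝ)..(Real.pi / 2), ellipticDelta s θ) := by
    rw [hK, ← hE]; ring
  rw [hKE]
  constructor
  · have hs2 : 1 - s ^ 2 ≠ 0 := by nlinarith
    have hd := ((((hasDerivAt_pow 2 s).add_const (1 : ℝ)).fun_mul hdA).fun_sub
      (((hasDerivAt_pow 2 s).fun_mul hdB).const_mul 2)).const_mul (32 / (3 * Real.pi ^ 2))
    refine (hd.congr_deriv ?_).congr_of_eventuallyEq ?_
    · generalize (∫ θ in (0:ℝ)..(Real.pi / 2), s * Real.cos θ ^ 2 * (ellipticDelta s θ)⁻¹) = A'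
        at hA ⊢
      generalize (∫ θ in (0:ℝ)..(Real.pi / 2),
        -(s * Real.cos θ ^ 2 * (ellipticDelta s θ)⁻¹ ^ 3)) = B' at hB ⊢
      generalize (∫ θ in (0:ℝ)..(Real.pi / 2), (ellipticDelta s θ)⁻¹ ^ 3) = C at hB hC
      generalize (∫ θ in (0:ℝ)..(Real.pi / 2), (ellipticDelta s θ)⁻¹) = B at hA hB ⊢
      generalize (∫ θ in (0:ℝ)..(Real.pi / 2), ellipticDelta s θ) = A at hA hC ⊢
      refine mul_left_cancel₀ hs2 ?_
      norm_num
      linear_combination 32 / (3 * Real.pi ^ 2) * ((s ^ 2 + 1) * hA - 2 * s ^ 2 * hB + 2 * s * hC)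
    · filter_upwards [Ioi_mem_nhds hs0] with x hx using Phi_eq_integral hx
  · rw [neg_mul, abs_neg, abs_of_nonneg]
    exact mul_nonneg (by positivity) (mul_nonneg hs0.le (sub_nonneg.2 hle))
end

section
/- There exists a constant $C > 0$ such that for all real numbers $a \le 0 \le b$ with $b - a \le 1$ and $[a,b] \subseteq [-1,1]$, one has $\left|\int_a^b \Phi(s)\,ds - (b-a)\,\Phi(0)\right| \le C\,(b-a)^{5/2}$. -/
open MeasureTheory

/-- An integrable majorant on `(0, 1)` for `1 / √(t (1 - t²))`. -/
noncomputable def endpointMajorant (t : ℝ) : ℝ :=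
  t ^ (-(1 / 2) : ℝ) + (1 - t) ^ (-(1 / 2) : ℝ)

lemma intervalIntegrable_endpointMajorant :
    IntervalIntegrable endpointMajorant volume 0 1 := by
  have h : IntervalIntegrable (fun t : ℝ => t ^ (-(1 / 2) : ℝ)) volume 0 1 :=
    intervalIntegral.intervalIntegrable_rpow' (by norm_num)
  have h' := (h.comp_sub_left 1).symm
  simp only [sub_zero, sub_self] at h'
  exact h.add h'

lemma endpointMajorant_nonneg {t : ℝ} (ht : t ∈ Set.Ioo (0 : ℝ) 1) : 0 ≤ endpointMajorant t :=
  add_nonneg (Real.rpow_nonneg ht.1.le _) (Real.rpow_nonneg (sub_nonneg.2 ht.2.le) _)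

lemma inv_sqrt_le_endpointMajorant {t : ℝ} (ht : t ∈ Set.Ioo (0 : ℝ) 1) :
    1 / (√t * √(1 - t ^ 2)) ≤ endpointMajorant t := by
  obtain ⟨h0, h1⟩ := ht
  have h1' : 0 < 1 - t := sub_pos.2 h1
  have hx : 0 < √t := Real.sqrt_pos.2 h0
  have hy : 0 < √(1 - t) := Real.sqrt_pos.2 h1'
  have hxx := Real.sq_sqrt h0.le
  have hyy := Real.sq_sqrt h1'.le
  have hle : √(1 - t) ≤ √(1 - t ^ 2) := Real.sqrt_le_sqrt (by nlinarith)
  rw [endpointMajorant, Real.rpow_neg h0.le, Real.rpow_neg h1'.le, ← Real.sqrt_eq_rpow,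
    ← Real.sqrt_eq_rpow]
  calc 1 / (√t * √(1 - t ^ 2)) ≤ 1 / (√t * √(1 - t)) := by gcongr
    _ ≤ (√t + √(1 - t)) / (√t * √(1 - t)) := by
      gcongr
      nlinarith [mul_pos hx hy]
    _ = (√t)⁻¹ + (√(1 - t))⁻¹ := by field_simp; ring

lemma ae_mem_Ioo_of_uIoc {p : ℝ → Prop} (h : ∀ t ∈ Set.Ioo (0 : ℝ) 1, p t) :
    ∀ᵐ t, t ∈ Set.uIoc (0 : ℝ) 1 → p t := by
  have h1 : ∀ᵐ t : ℝ, t ≠ 1 := by simp [ae_iff, measure_singleton]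
  filter_upwards [h1] with t ht htI
  rw [Set.uIoc_of_le zero_le_one] at htI
  exact h t ⟨htI.1, lt_of_le_of_ne htI.2 ht⟩

lemma intervalIntegrable_of_le_endpointMajorant {f : ℝ → ℝ} (hf : Measurable f) {c : ℝ}
    (h : ∀ t ∈ Set.Ioo (0 : ℝ) 1, |f t| ≤ c * endpointMajorant t) :
    IntervalIntegrable f volume 0 1 := by
  refine (intervalIntegrable_endpointMajorant.const_mul c).mono_fun'
    hf.aestronglyMeasurable ?_
  exact (ae_restrict_iff' measurableSet_uIoc).2 (ae_mem_Ioo_of_uIoc h)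

lemma integral_le_of_Ioo {f g : ℝ → ℝ} (hf : IntervalIntegrable f volume 0 1)
    (hg : IntervalIntegrable g volume 0 1) (h : ∀ t ∈ Set.Ioo (0 : ℝ) 1, f t ≤ g t) :
    ∫ t in (0 : ℝ)..1, f t ≤ ∫ t in (0 : ℝ)..1, g t :=
  intervalIntegral.integral_mono_on_of_le_Ioo zero_le_one hf hg h

lemma integral_congr_Ioo {f g : ℝ → ℝ} (h : ∀ t ∈ Set.Ioo (0 : ℝ) 1, f t = g t) :
    ∫ t in (0 : ℝ)..1, f t = ∫ t in (0 : ℝ)..1, g t :=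
  intervalIntegral.integral_congr_ae (ae_mem_Ioo_of_uIoc h)

lemma one_sub_sq_pos {t : ℝ} (ht : t ∈ Set.Ioo (0 : ℝ) 1) : 0 < 1 - t ^ 2 := by
  nlinarith [ht.1, ht.2]

lemma id_div_sqrt_le_endpointMajorant {t : ℝ} (ht : t ∈ Set.Ioo (0 : ℝ) 1) :
    t / √(1 - t ^ 2) ≤ endpointMajorant t := by
  refine le_trans ?_ (inv_sqrt_le_endpointMajorant ht)
  have hx : 0 < √t := Real.sqrt_pos.2 ht.1
  have hz : 0 < √(1 - t ^ 2) := Real.sqrt_pos.2 (one_sub_sq_pos ht)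
  have hx1 : √t ≤ 1 := Real.sqrt_le_one.2 ht.2.le
  rw [div_le_div_iff₀ hz (by positivity)]
  have : t * √t ≤ 1 := mul_le_one₀ ht.2.le hx.le hx1
  nlinarith

lemma intervalIntegrable_id_div_sqrt :
    IntervalIntegrable (fun t : ℝ => t / √(1 - t ^ 2)) volume 0 1 := by
  refine intervalIntegrable_of_le_endpointMajorant (by fun_prop) (c := 1) fun t ht => ?_
  rw [one_mul, abs_of_nonneg (div_nonneg ht.1.le (Real.sqrt_nonneg _))]
  exact id_div_sqrt_le_endpointMajorant ht

lemma integral_id_div_sqrt : ∫ t in (0 : ℝ)..1, t / √(1 - t ^ 2) = 1 := by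
  rw [intervalIntegral.integral_eq_sub_of_hasDerivAt_of_le (f := fun t : ℝ => -√(1 - t ^ 2))
    zero_le_one (by fun_prop) _ intervalIntegrable_id_div_sqrt]
  · simp
  · intro t ht
    have hpos := one_sub_sq_pos ht
    have h : HasDerivAt (fun t : ℝ => 1 - t ^ 2) (-(2 * t)) t := by
      simpa using (hasDerivAt_pow 2 t).const_sub 1
    have hz : 0 < √(1 - t ^ 2) := Real.sqrt_pos.2 hpos
    refine (h.sqrt hpos.ne').fun_neg.congr_deriv ?_
    field_simp

section Rescaled

variable {r t : ℝ}

lemma le_sqrt_rescaled (ht : t ∈ Set.Ioo (0 : ℝ) 1) :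
    t ≤ √(t ^ 2 + r ^ 2 * (1 - t ^ 2)) :=
  Real.le_sqrt_of_sq_le (by nlinarith [mul_nonneg (sq_nonneg r) (one_sub_sq_pos ht).le])

lemma sqrt_one_sub_mul_sq (hr : 0 < r) :
    √(1 - (1 - 1 / r ^ 2) * t ^ 2) = √(t ^ 2 + r ^ 2 * (1 - t ^ 2)) / r := by
  have h : 1 - (1 - 1 / r ^ 2) * t ^ 2 = (t ^ 2 + r ^ 2 * (1 - t ^ 2)) / r ^ 2 := by
    field_simp
    ring
  rw [h, Real.sqrt_div' _ (sq_nonneg r), Real.sqrt_sq hr.le]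

lemma mul_ellipticE (hr : 0 < r) :
    r * ellipticE (1 - 1 / r ^ 2) =
      ∫ t in (0 : ℝ)..1, √(t ^ 2 + r ^ 2 * (1 - t ^ 2)) / √(1 - t ^ 2) := by
  rw [ellipticE, ← intervalIntegral.integral_const_mul]
  refine integral_congr_Ioo fun t _ => ?_
  rw [sqrt_one_sub_mul_sq hr]
  field_simp

lemma mul_ellipticK (hr : 0 < r) :
    r * ellipticK (1 - 1 / r ^ 2) =
      ∫ t in (0 : ℝ)..1, r ^ 2 / (√(t ^ 2 + r ^ 2 * (1 - t ^ 2)) * √(1 - t ^ 2)) := by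
  rw [ellipticK, ← intervalIntegral.integral_const_mul]
  refine integral_congr_Ioo fun t ht => ?_
  rw [Real.sqrt_mul (one_sub_sq_pos ht).le, sqrt_one_sub_mul_sq hr]
  have hz : 0 < √(1 - t ^ 2) := Real.sqrt_pos.2 (one_sub_sq_pos ht)
  have hw : 0 < √(t ^ 2 + r ^ 2 * (1 - t ^ 2)) := ht.1.trans_le (le_sqrt_rescaled ht)
  generalize √(t ^ 2 + r ^ 2 * (1 - t ^ 2)) = w at hw ⊢
  generalize √(1 - t ^ 2) = z at hz ⊢
  field_simp

lemma sqrt_mul_sqrt_le_sqrt_rescaled (hr : 0 < r) (hr1 : r ≤ 1) (ht : t ∈ Set.Ioo (0 : ℝ) 1) :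
    √r * √t ≤ √(t ^ 2 + r ^ 2 * (1 - t ^ 2)) := by
  rw [← Real.sqrt_mul hr.le]
  refine Real.sqrt_le_sqrt ?_
  have h1 : 0 ≤ r ^ 2 * (1 - t ^ 2) := mul_nonneg (sq_nonneg r) (one_sub_sq_pos ht).le
  have h2 : 0 ≤ t ^ 2 * (1 - r ^ 2) := mul_nonneg (sq_nonneg t) (by nlinarith)
  rcases le_total r t with h | h
  · nlinarith [ht.1]
  · nlinarith [ht.1]

lemma K_integrand_le (hr : 0 < r) (hr1 : r ≤ 1) (ht : t ∈ Set.Ioo (0 : ℝ) 1) :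
    r ^ 2 / (√(t ^ 2 + r ^ 2 * (1 - t ^ 2)) * √(1 - t ^ 2)) ≤
      r ^ (3 / 2 : ℝ) * endpointMajorant t := by
  have hx : 0 < √t := Real.sqrt_pos.2 ht.1
  have hs : 0 < √r := Real.sqrt_pos.2 hr
  have hz : 0 < √(1 - t ^ 2) := Real.sqrt_pos.2 (one_sub_sq_pos ht)
  have hpow : r ^ (3 / 2 : ℝ) * √r = r ^ 2 := by
    rw [Real.sqrt_eq_rpow, ← Real.rpow_add hr, ← Real.rpow_natCast]
    norm_num
  calc _ ≤ r ^ 2 / (√r * √t * √(1 - t ^ 2)) := by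
        gcongr
        exact sqrt_mul_sqrt_le_sqrt_rescaled hr hr1 ht
    _ = r ^ (3 / 2 : ℝ) * (1 / (√t * √(1 - t ^ 2))) := by
        rw [← hpow]
        field_simp
    _ ≤ _ := by
        gcongr
        exact inv_sqrt_le_endpointMajorant ht

lemma E_integrand_le (ht : t ∈ Set.Ioo (0 : ℝ) 1) :
    √(t ^ 2 + r ^ 2 * (1 - t ^ 2)) / √(1 - t ^ 2) ≤
      t / √(1 - t ^ 2) + r ^ 2 / (√(t ^ 2 + r ^ 2 * (1 - t ^ 2)) * √(1 - t ^ 2)) := by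
  have hz : 0 < √(1 - t ^ 2) := Real.sqrt_pos.2 (one_sub_sq_pos ht)
  have hle := le_sqrt_rescaled (r := r) ht
  have hsq : √(t ^ 2 + r ^ 2 * (1 - t ^ 2)) ^ 2 = t ^ 2 + r ^ 2 * (1 - t ^ 2) :=
    Real.sq_sqrt (by nlinarith [mul_nonneg (sq_nonneg r) (one_sub_sq_pos ht).le])
  set w := √(t ^ 2 + r ^ 2 * (1 - t ^ 2))
  have hw : 0 < w := ht.1.trans_le hle
  rw [← div_div, ← add_div]
  gcongr
  rw [← sub_le_iff_le_add', le_div_iff₀ hw]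
  nlinarith [mul_nonneg ht.1.le (sub_nonneg.2 hle), mul_nonneg (sq_nonneg r) (sq_nonneg t)]

lemma intervalIntegrable_K_integrand (hr : 0 < r) (hr1 : r ≤ 1) :
    IntervalIntegrable
      (fun t : ℝ => r ^ 2 / (√(t ^ 2 + r ^ 2 * (1 - t ^ 2)) * √(1 - t ^ 2))) volume 0 1 := by
  refine intervalIntegrable_of_le_endpointMajorant (by fun_prop)
    (c := r ^ (3 / 2 : ℝ)) fun t ht => ?_
  rw [abs_of_nonneg (by positivity)]
  exact K_integrand_le hr hr1 ht

lemma intervalIntegrable_E_integrand (hr : 0 < r) (hr1 : r ≤ 1) :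
    IntervalIntegrable
      (fun t : ℝ => √(t ^ 2 + r ^ 2 * (1 - t ^ 2)) / √(1 - t ^ 2)) volume 0 1 := by
  refine intervalIntegrable_of_le_endpointMajorant (by fun_prop)
    (c := 1 + r ^ (3 / 2 : ℝ)) fun t ht => ?_
  rw [abs_of_nonneg (by positivity)]
  linarith [E_integrand_le (r := r) ht, K_integrand_le hr hr1 ht, id_div_sqrt_le_endpointMajorant ht]

lemma mul_ellipticK_nonneg (hr : 0 < r) : 0 ≤ r * ellipticK (1 - 1 / r ^ 2) := by
  rw [mul_ellipticK hr]
  exact intervalIntegral.integral_nonneg zero_le_one fun t _ => by positivity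

lemma mul_ellipticK_le (hr : 0 < r) (hr1 : r ≤ 1) :
    r * ellipticK (1 - 1 / r ^ 2) ≤
      r ^ (3 / 2 : ℝ) * ∫ t in (0 : ℝ)..1, endpointMajorant t := by
  rw [mul_ellipticK hr, ← intervalIntegral.integral_const_mul]
  exact integral_le_of_Ioo (intervalIntegrable_K_integrand hr hr1)
    (intervalIntegrable_endpointMajorant.const_mul _) fun t ht => K_integrand_le hr hr1 ht

lemma one_le_mul_ellipticE (hr : 0 < r) (hr1 : r ≤ 1) :
    1 ≤ r * ellipticE (1 - 1 / r ^ 2) := by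
  rw [mul_ellipticE hr]
  refine integral_id_div_sqrt.ge.trans ?_
  refine integral_le_of_Ioo intervalIntegrable_id_div_sqrt
    (intervalIntegrable_E_integrand hr hr1) fun t ht => ?_
  gcongr
  exact le_sqrt_rescaled ht

lemma mul_ellipticE_le (hr : 0 < r) (hr1 : r ≤ 1) :
    r * ellipticE (1 - 1 / r ^ 2) ≤ 1 + r * ellipticK (1 - 1 / r ^ 2) := by
  have hadd := intervalIntegral.integral_add intervalIntegrable_id_div_sqrt
    (intervalIntegrable_K_integrand hr hr1)
  rw [integral_id_div_sqrt] at hadd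
  rw [mul_ellipticE hr, mul_ellipticK hr, ← hadd]
  exact integral_le_of_Ioo (intervalIntegrable_E_integrand hr hr1)
    (intervalIntegrable_id_div_sqrt.add (intervalIntegrable_K_integrand hr hr1))
    fun t ht => E_integrand_le ht

end Rescaled

lemma measurable_intervalIntegral_left {f : ℝ → ℝ → ℝ} (hf : Measurable (Function.uncurry f)) :
    Measurable fun k => ∫ t in (0 : ℝ)..1, f k t := by
  simp only [intervalIntegral.integral_of_le zero_le_one]
  exact (hf.stronglyMeasurable.integral_prod_right
    (ν := volume.restrict (Set.Ioc (0 : ℝ) 1))).measurable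

lemma measurable_ellipticE : Measurable ellipticE :=
  measurable_intervalIntegral_left (by unfold Function.uncurry; fun_prop)

lemma measurable_ellipticK : Measurable ellipticK :=
  measurable_intervalIntegral_left (by unfold Function.uncurry; fun_prop)

lemma measurable_Phi : Measurable Phi := by
  have hE := measurable_ellipticE
  have hK := measurable_ellipticK
  have habs : Measurable fun s : ℝ => |s| := continuous_abs.measurable
  exact Measurable.ite (measurableSet_singleton 0) measurable_const (by fun_prop)

/-- `Φ` is `3/2`-Hölder at the origin. -/
lemma exists_abs_Phi_sub_le :
    ∃ C : ℝ, 0 < C ∧ ∀ s : ℝ, |s| ≤ 1 → |Phi s - Phi 0| ≤ C * |s| ^ (3 / 2 : ℝ) := by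
  set M := ∫ t in (0 : ℝ)..1, endpointMajorant t
  have hM : 0 ≤ M := by
    simpa using integral_le_of_Ioo (f := fun _ => 0) (by simp)
      intervalIntegrable_endpointMajorant fun t ht => endpointMajorant_nonneg ht
  have hc : 0 < 32 / (3 * Real.pi ^ 2) := by positivity
  refine ⟨32 / (3 * Real.pi ^ 2) * (1 + 4 * M), by positivity, fun s hs => ?_⟩
  rcases eq_or_ne s 0 with rfl | hs0
  · simp
  have hr : 0 < |s| := abs_pos.2 hs0
  have hK0 := mul_ellipticK_nonneg hr
  have hK := mul_ellipticK_le hr hs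
  have hE1 := one_le_mul_ellipticE hr hs
  have hE := mul_ellipticE_le hr hs
  have hdiff : Phi s - Phi 0 = 32 / (3 * Real.pi ^ 2) *
      ((|s| ^ 2 + 1) * (|s| * ellipticE (1 - 1 / |s| ^ 2)) - 1
        - 2 * (|s| * ellipticK (1 - 1 / |s| ^ 2))) := by
    simp only [Phi, if_neg hs0, if_true, sq_abs]
    ring
  rw [hdiff, abs_mul, abs_of_pos hc, mul_assoc]
  refine mul_le_mul_of_nonneg_left ?_ hc.le
  have hp : |s| ^ 2 ≤ |s| ^ (3 / 2 : ℝ) := by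
    rw [← Real.rpow_natCast]
    exact Real.rpow_le_rpow_of_exponent_ge hr hs (by norm_num)
  have hsq : |s| ^ 2 ≤ 1 := pow_le_one₀ hr.le hs
  change _ ≤ _ * M at hK
  set r := |s|
  set e := r * ellipticE (1 - 1 / r ^ 2)
  set κ := r * ellipticK (1 - 1 / r ^ 2)
  have hbound : r ^ 2 * κ ≤ κ := mul_le_of_le_one_left hK0 hsq
  have hbound' : r ^ 2 * e ≤ r ^ 2 * (1 + κ) := mul_le_mul_of_nonneg_left hE (sq_nonneg r)
  have hnn : 0 ≤ r ^ 2 * e := mul_nonneg (sq_nonneg r) (by linarith)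
  have hpow : 0 ≤ r ^ (3 / 2 : ℝ) := by positivity
  rw [abs_le]
  constructor <;> nlinarith [mul_nonneg hM hpow]

lemma intervalIntegrable_Phi {a b : ℝ} (ha : -1 ≤ a) (hab : a ≤ b) (hb : b ≤ 1) :
    IntervalIntegrable Phi volume a b := by
  obtain ⟨C, hC, h⟩ := exists_abs_Phi_sub_le
  refine (intervalIntegrable_const (c := |Phi 0| + C)).mono_fun'
    measurable_Phi.aestronglyMeasurable ?_
  refine (ae_restrict_iff' measurableSet_uIoc).2 (Filter.Eventually.of_forall fun s hs => ?_)
  rw [Set.uIoc_of_le hab] at hs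
  have hs1 : |s| ≤ 1 := abs_le.2 ⟨by linarith [hs.1], by linarith [hs.2]⟩
  have hle : C * |s| ^ (3 / 2 : ℝ) ≤ C :=
    mul_le_of_le_one_right hC.le (Real.rpow_le_one (abs_nonneg s) hs1 (by norm_num))
  have htri := abs_sub_abs_le_abs_sub (Phi s) (Phi 0)
  change |Phi s| ≤ |Phi 0| + C
  linarith [h s hs1]

/-- There is a constant `C > 0` such that for all `a ≤ 0 ≤ b` with `b - a ≤ 1` and
`[a,b] ⊆ [-1,1]`, one has `|∫_a^b Φ(s) ds - (b-a)Φ(0)| ≤ C (b-a)^(5/2)`. -/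
theorem integral_phi_approx :
    ∃ C : ℝ, 0 < C ∧ ∀ a b : ℝ, a ≤ 0 → 0 ≤ b → b - a ≤ 1 → -1 ≤ a → b ≤ 1 →
      |(∫ s in a..b, Phi s) - (b - a) * Phi 0| ≤ C * (b - a) ^ ((5 : ℝ) / 2) := by
  obtain ⟨C, hC, h⟩ := exists_abs_Phi_sub_le
  refine ⟨C, hC, fun a b ha hb _ ha1 hb1 => ?_⟩
  have hab : a ≤ b := ha.trans hb
  have hd : 0 ≤ b - a := sub_nonneg.2 hab
  have hsplit : (∫ s in a..b, Phi s) - (b - a) * Phi 0 = ∫ s in a..b, (Phi s - Phi 0) := by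
    rw [intervalIntegral.integral_sub (intervalIntegrable_Phi ha1 hab hb1)
      intervalIntegrable_const, intervalIntegral.integral_const, smul_eq_mul]
  have hpow : (b - a) ^ ((5 : ℝ) / 2) = (b - a) ^ (3 / 2 : ℝ) * (b - a) := by
    rw [← Real.rpow_add_one' hd (by norm_num)]
    norm_num
  have hbound : ∀ s ∈ Set.uIoc a b, ‖Phi s - Phi 0‖ ≤ C * (b - a) ^ (3 / 2 : ℝ) := by
    intro s hs
    rw [Set.uIoc_of_le hab] at hs
    have hs1 : |s| ≤ 1 := abs_le.2 ⟨by linarith [hs.1], by linarith [hs.2]⟩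
    have hsd : |s| ≤ b - a := abs_le.2 ⟨by linarith [hs.1], by linarith [hs.2]⟩
    refine (h s hs1).trans ?_
    gcongr
  have key := intervalIntegral.norm_integral_le_of_norm_le_const hbound
  rw [abs_of_nonneg hd, Real.norm_eq_abs] at key
  rw [hsplit, hpow, ← mul_assoc]
  exact key
end
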